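/- Let F and G be probability measures on ℝ and suppose the centred quadratic stochastic operator Q_G is weakly asymptotically stable at F, i.e. the iterates Q_G^n(F) converge weakly to a probability measure H⁽∞⁾. Then for every s ∈ ℝ the characteristic functions satisfy φ_{H⁽∞⁾}(s) = (φ_{H⁽∞⁾}(s/2))² · φ_G(s). -/

import Mathlib

open MeasureTheory Filter Topology

/-- The characteristic function of a finite Borel measure on `ℝ`. -/
noncomputable def charFnR (H : Measure ℝ) (s : ℝ) : ℂ :=
  ∫ x, Complex.exp (((s * x : ℝ) : ℂ) * Complex.I) ∂H

/-- The centred quadratic stochastic operator `Q_G(F) = Ḟ ∗ Ḟ ∗ G` on `ℝ`. -/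
noncomputable def cqsoR (G F : Measure ℝ) : Measure ℝ :=
  ((F.map (fun x => x / 2)).conv (F.map (fun x => x / 2))).conv G

/-- Weak convergence of a sequence of measures. -/
def WeakTendsto {E : Type*} [MeasurableSpace E] [TopologicalSpace E]
    (μ : ℕ → Measure E) (ν : Measure E) : Prop :=
  ∀ f : BoundedContinuousFunction E ℝ,
    Tendsto (fun n => ∫ x, f x ∂(μ n)) atTop (𝓝 (∫ x, f x ∂ν))

lemma charFnR_eq_charFun (H : Measure ℝ) (s : ℝ) : charFnR H s = charFun H s := by
  rw [charFun_apply_real, charFnR]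
  simp

lemma isProb_cqsoR (G F : Measure ℝ) [IsProbabilityMeasure F] [IsProbabilityMeasure G] :
    IsProbabilityMeasure (cqsoR G F) := by
  have : IsProbabilityMeasure (F.map (fun x => x / 2)) :=
    Measure.isProbabilityMeasure_map (by fun_prop)
  unfold cqsoR
  infer_instance

lemma charFun_cqsoR (G F : Measure ℝ) [IsProbabilityMeasure F] [IsProbabilityMeasure G] (s : ℝ) :
    charFun (cqsoR G F) s = (charFun F (s / 2)) ^ 2 * charFun G s := by
  have : IsProbabilityMeasure (F.map (fun x => x / 2)) :=
    Measure.isProbabilityMeasure_map (by fun_prop)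
  have h2 : charFun (F.map (fun x => x / 2)) s = charFun F (s / 2) := by
    have h := charFun_map_mul (μ := F) (2⁻¹) s
    have e : (fun x : ℝ => x / 2) = (2⁻¹ * ·) := by
      funext x; ring
    rw [e, h]
    congr 1; ring
  unfold cqsoR
  rw [charFun_conv, charFun_conv, h2, sq]

theorem weak_limit_functional_equation (F G Hinf : Measure ℝ)
    [IsProbabilityMeasure F] [IsProbabilityMeasure G] [IsProbabilityMeasure Hinf]
    (hstab : WeakTendsto (fun n => (cqsoR G)^[n] F) Hinf) :
    ∀ s : ℝ, charFnR Hinf s = (charFnR Hinf (s / 2)) ^ 2 * charFnR G s := by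
  have hp : ∀ n, IsProbabilityMeasure ((cqsoR G)^[n] F) := by
    intro n
    induction n with
    | zero => simpa
    | succ n ih =>
      rw [Function.iterate_succ_apply']
      exact isProb_cqsoR _ _
  have ht : ∀ s, Tendsto (fun n => charFun ((cqsoR G)^[n] F) s) atTop (𝓝 (charFun Hinf s)) := by
    have h := (ProbabilityMeasure.tendsto_iff_tendsto_charFun
      (μ := fun n => (⟨(cqsoR G)^[n] F, hp n⟩ : ProbabilityMeasure ℝ))
      (μ₀ := (⟨Hinf, inferInstance⟩ : ProbabilityMeasure ℝ))).1
      (ProbabilityMeasure.tendsto_iff_forall_integral_tendsto.2 hstab)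
    exact h
  intro s
  simp only [charFnR_eq_charFun]
  refine tendsto_nhds_unique ((tendsto_add_atTop_iff_nat 1).2 (ht s)) ?_
  have h := ((ht (s / 2)).pow 2).mul_const (charFun G s)
  refine h.congr fun n => ?_
  have := hp n
  rw [Function.iterate_succ_apply', charFun_cqsoR]
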